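/- On V ⊗ V ⊗ V the identity P_q^{(12)} ∘ Q_q^{(23)} ∘ Q_q^{(12)} = −P_q^{(23)} ∘ Q_q^{(12)} holds. -/

import Mathlib

open scoped BigOperators

noncomputable section

/-- The index set `I = {-r, …, -1, 1, …, r}` as a subtype of `ℤ`. -/
abbrev SIdx (r : ℕ) : Type := {i : ℤ // i ∈ (Finset.Icc (-(r : ℤ)) (r : ℤ)).erase 0}

instance (r : ℕ) : Neg (SIdx r) :=
  ⟨fun i => ⟨-i.1, by
    obtain ⟨h1, h2⟩ := Finset.mem_erase.mp i.2
    rw [Finset.mem_Icc] at h2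
    exact Finset.mem_erase.mpr ⟨neg_ne_zero.mpr h1, Finset.mem_Icc.mpr (by omega)⟩⟩⟩

/-- The sign `ε_i`: `1` for `i > 0` and `-1` for `i < 0`, as an element of `K`. -/
def sgn (K : Type*) [Field K] {r : ℕ} (i : SIdx r) : K := if 0 < i.1 then 1 else -1

/-- A symplectic parameter family `q = (q_{ij}, q_i)`: nonzero scalars with
`q_{ij} = q_{ji}⁻¹`, `q_{ii} = 1`, `q_{-i} = q_i⁻¹` and `q_{-i,j} = q_{ij}⁻¹ q_j²`. -/
structure SympParam (K : Type*) [Field K] (r : ℕ) where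
  qm : SIdx r → SIdx r → K
  qv : SIdx r → K
  qm_ne : ∀ i j, qm i j ≠ 0
  qv_ne : ∀ i, qv i ≠ 0
  qm_symm : ∀ i j, qm i j = (qm j i)⁻¹
  qm_diag : ∀ i, qm i i = 1
  qv_neg : ∀ i, qv (-i) = (qv i)⁻¹
  qm_neg : ∀ i j, qm (-i) j = (qm i j)⁻¹ * (qv j) ^ 2

variable {K : Type*} [Field K] [CharZero K] {r : ℕ}

/-- The operator `P_q` on `V ⊗ V`, where `V = SIdx r → K` and `V ⊗ V` is realized as
`(SIdx r × SIdx r) → K` with basis vector `e l ⊗ e m = Pi.single (l, m) 1`.  It sends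
`e l ⊗ e m ↦ q_{lm} • (e m ⊗ e l)`. -/
def Pq (q : SympParam K r) : Module.End K (SIdx r × SIdx r → K) where
  toFun f := fun p => q.qm p.2 p.1 * f (p.2, p.1)
  map_add' f g := by funext p; simp [mul_add]
  map_smul' c f := by funext p; simp [smul_eq_mul]; ring

/-- The operator `Q_q` on `V ⊗ V`: it sends
`e l ⊗ e m ↦ δ_{m,-l} ε_l q_l⁻¹ • ∑ i, ε_i q_i • (e i ⊗ e (-i))`. -/
def Qq (q : SympParam K r) : Module.End K (SIdx r × SIdx r → K) where
  toFun f := fun p =>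
    if p.2 = -p.1 then
      sgn K p.1 * q.qv p.1 * ∑ l : SIdx r, sgn K l * (q.qv l)⁻¹ * f (l, -l)
    else 0
  map_add' f g := by
    funext p
    by_cases h : p.2 = -p.1 <;> simp [h, mul_add, Finset.sum_add_distrib]
  map_smul' c f := by
    funext p
    by_cases h : p.2 = -p.1 <;>
      simp only [h, if_true, if_false, Pi.smul_apply, smul_eq_mul, RingHom.id_apply,
        Finset.mul_sum, mul_zero]
    · exact Finset.sum_congr rfl fun l _ => by ring

/-- The operator `T^{(a,b)}` on `V^{⊗k} = (Fin k → SIdx r) → K` (for `a ≠ b`): it acts as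
`T` on the `a`-th and `b`-th tensor factors and as the identity on all other factors. -/
def liftAB {k : ℕ} (T : Module.End K (SIdx r × SIdx r → K)) (a b : Fin k) :
    Module.End K ((Fin k → SIdx r) → K) where
  toFun f := fun v => ∑ l : SIdx r, ∑ m : SIdx r,
    T (Pi.single (l, m) 1) (v a, v b) * f (Function.update (Function.update v a l) b m)
  map_add' f g := by
    funext v
    simp [mul_add, Finset.sum_add_distrib]
  map_smul' c f := by
    funext v
    simp only [Pi.smul_apply, smul_eq_mul, RingHom.id_apply, Finset.mul_sum]
    congr 1; funext l; congr 1; funext m; ring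

theorem SIdx.neg_neg (i : SIdx r) : - -i = i := Subtype.ext (_root_.neg_neg i.1)

theorem sgn_mul_self {K : Type*} [Field K] (i : SIdx r) : sgn K i * sgn K i = 1 := by
  unfold sgn
  split_ifs <;> simp

theorem sgn_neg {K : Type*} [Field K] (i : SIdx r) : sgn K (-i) = -sgn K i := by
  have hi : i.1 ≠ 0 := (Finset.mem_erase.mp i.2).1
  have hneg : (-i).1 = -i.1 := rfl
  unfold sgn
  rw [hneg]
  split_ifs <;> first | omega | simp

theorem liftAB_Pq_apply {K : Type*} [Field K] {k : ℕ} (q : SympParam K r) (a b : Fin k)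
    (f : (Fin k → SIdx r) → K) (v : Fin k → SIdx r) :
    liftAB (Pq q) a b f v =
      q.qm (v b) (v a) * f (Function.update (Function.update v a (v b)) b (v a)) := by
  change ∑ l, ∑ m, q.qm (v b) (v a) * (Pi.single (l, m) 1 : SIdx r × SIdx r → K) (v b, v a) *
    f (Function.update (Function.update v a l) b m) = _
  rw [Finset.sum_eq_single (v b), Finset.sum_eq_single (v a)]
  · simp
  · intro m _ hm
    simp [hm.symm]
  · simp
  · intro l _ hl
    simp [hl.symm]
  · simp

theorem liftAB_Qq_apply {k : ℕ} (q : SympParam K r) (a b : Fin k)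
    (f : (Fin k → SIdx r) → K) (v : Fin k → SIdx r) :
    liftAB (Qq q) a b f v =
      if v b = -v a then
        sgn K (v a) * q.qv (v a) * ∑ l, sgn K l * (q.qv l)⁻¹ *
          f (Function.update (Function.update v a l) b (-l))
      else 0 := by
  change ∑ l, ∑ m, (if v b = -v a then sgn K (v a) * q.qv (v a) *
      ∑ i, sgn K i * (q.qv i)⁻¹ * (Pi.single (l, m) 1 : SIdx r × SIdx r → K) (i, -i) else 0) *
    f (Function.update (Function.update v a l) b m) = _
  split_ifs with h
  · rw [Finset.mul_sum]
    refine Finset.sum_congr rfl fun l _ => ?_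
    have hsum (m : SIdx r) :
        ∑ i, sgn K i * (q.qv i)⁻¹ * (Pi.single (l, m) 1 : SIdx r × SIdx r → K) (i, -i) =
          if m = -l then sgn K l * (q.qv l)⁻¹ else 0 := by
      rw [Finset.sum_eq_single l]
      · simp [Pi.single_apply, eq_comm]
      · intro i _ hi
        simp [hi]
      · simp
    simp only [hsum]
    rw [Finset.sum_eq_single (-l)]
    · simp [mul_assoc]
    · intro m _ hm
      simp [hm]
    · simp
  · simp

/-- `P_q^{(12)} ∘ Q_q^{(23)} ∘ Q_q^{(12)} = −P_q^{(23)} ∘ Q_q^{(12)}` on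
`V ⊗ V ⊗ V`. -/
theorem Pq_Qq_relation (hr : 1 ≤ r) (q : SympParam K r) :
    liftAB (k := 3) (Pq q) 0 1 ∘ₗ liftAB (Qq q) 1 2 ∘ₗ liftAB (Qq q) 0 1
      = -(liftAB (k := 3) (Pq q) 1 2 ∘ₗ liftAB (Qq q) 0 1) := by
  refine LinearMap.ext fun f => funext fun v => ?_
  obtain ⟨x, y, z, rfl⟩ : ∃ x y z, v = ![x, y, z] :=
    ⟨v 0, v 1, v 2, by ext i; fin_cases i <;> rfl⟩
  have upd01 (a b c l m : SIdx r) :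
      Function.update (Function.update ![a, b, c] 0 l) 1 m = ![l, m, c] := by
    ext i; fin_cases i <;> rfl
  have upd12 (a b c l m : SIdx r) :
      Function.update (Function.update ![a, b, c] 1 l) 2 m = ![a, l, m] := by
    ext i; fin_cases i <;> rfl
  have v0 (a b c : SIdx r) : ![a, b, c] 0 = a := rfl
  have v1 (a b c : SIdx r) : ![a, b, c] 1 = b := rfl
  have v2 (a b c : SIdx r) : ![a, b, c] 2 = c := rfl
  simp only [LinearMap.comp_apply, LinearMap.neg_apply, Pi.neg_apply, liftAB_Pq_apply,
    liftAB_Qq_apply, upd01, upd12, v0, v1, v2]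
  by_cases h : z = -x
  · subst h
    rw [if_pos rfl, if_pos rfl, Finset.sum_eq_single (-y)]
    · rw [if_pos rfl, SIdx.neg_neg, sgn_neg, q.qv_neg, inv_inv, q.qm_neg, ← q.qm_symm]
      linear_combination (-(q.qm y x * sgn K x * q.qv x * q.qv y ^ 2 *
        ∑ l, sgn K l * (q.qv l)⁻¹ * f ![l, -l, y])) * sgn_mul_self (K := K) y
    · intro l _ hl
      rw [if_neg hl, mul_zero]
    · simp
  · simp [h]
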